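/- Let A be a J-algebra and a, b ∈ A with a˘;a ≤ 1', b˘;b ≤ 1', and 1 = a˘;b. Then for every x ∈ A, (a˘·b˘);((a;x;a˘)·(b;b˘));a = x. -/

import Mathlib

/-- A J-algebra: an algebra (A, ·, 0, 1, ;, ˘, 1') satisfying Jónsson's axioms. -/
structure JAlgebra (A : Type*) where
  meet : A → A → A        -- Boolean product ·
  comp : A → A → A        -- relative product ;
  conv : A → A            -- converse ˘
  zero : A                -- 0
  one : A                 -- 1
  ident : A               -- 1'
  massoc : ∀ x y z, meet x (meet y z) = meet (meet x y) z
  mcomm : ∀ x y, meet x y = meet y x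
  midem : ∀ x, meet x x = x
  cassoc : ∀ x y z, comp x (comp y z) = comp (comp x y) z
  cid : ∀ x, comp x ident = x
  semidist : ∀ x y z, comp (meet x y) z = meet (comp (meet x y) z) (comp y z)
  convconv : ∀ x, conv (conv x) = x
  convcomp : ∀ x y, conv (comp x y) = comp (conv y) (conv x)
  convmeet : ∀ x y, conv (meet x y) = meet (conv x) (conv y)
  rot : ∀ x y z, meet (comp x y) z =
    meet (comp (meet (comp z (conv y)) x) (meet y (comp (conv x) z))) z
  zbot : ∀ x, meet zero x = zero
  otop : ∀ x, meet x one = x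
  comp_zero : ∀ x, comp x zero = zero

/-- x ≤ y iff x·y = x. -/
def JAlgebra.le {A : Type*} (J : JAlgebra A) (x y : A) : Prop := J.meet x y = x

/-- x is functional iff x˘;x ≤ 1'. -/
def JAlgebra.Functional {A : Type*} (J : JAlgebra A) (x : A) : Prop :=
  J.le (J.comp (J.conv x) x) J.ident

/-- x is permutational iff x;x˘ = 1' = x˘;x. -/
def JAlgebra.Permutational {A : Type*} (J : JAlgebra A) (x : A) : Prop :=
  J.comp x (J.conv x) = J.ident ∧ J.comp (J.conv x) x = J.ident

namespace JAlgebra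

variable {A : Type*} (J : JAlgebra A) {x y z w : A}

theorem le_trans (hxy : J.le x y) (hyz : J.le y z) : J.le x z := by
  unfold le at *
  rw [← hxy, ← J.massoc, hyz]

theorem le_antisymm (hxy : J.le x y) (hyx : J.le y x) : x = y := by
  unfold le at *
  rw [← hxy, J.mcomm, hyx]

theorem meet_le_left : J.le (J.meet x y) x := by
  unfold le
  rw [J.mcomm, J.massoc, J.midem]

theorem meet_le_right : J.le (J.meet x y) y := by
  unfold le
  rw [← J.massoc, J.midem]

theorem le_meet (hy : J.le x y) (hz : J.le x z) : J.le x (J.meet y z) := by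
  unfold le at *
  rw [J.massoc, hy, hz]

theorem conv_le_conv (h : J.le x y) : J.le (J.conv x) (J.conv y) := by
  unfold le at *
  rw [← J.convmeet, h]

theorem comp_le_comp_right (h : J.le x y) (z : A) : J.le (J.comp x z) (J.comp y z) := by
  have hs := J.semidist x y z
  unfold le at *
  rw [h] at hs
  exact hs.symm

theorem comp_le_comp_left (h : J.le x y) (z : A) : J.le (J.comp z x) (J.comp z y) := by
  have hc := J.conv_le_conv (J.comp_le_comp_right (J.conv_le_conv h) (J.conv z))
  simpa only [J.convcomp, J.convconv] using hc

theorem comp_le_comp (hxy : J.le x y) (hzw : J.le z w) :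
    J.le (J.comp x z) (J.comp y w) :=
  J.le_trans (J.comp_le_comp_right hxy z) (J.comp_le_comp_left hzw y)

theorem conv_ident : J.conv J.ident = J.ident := by
  have h := J.convcomp (J.conv J.ident) J.ident
  rwa [J.cid, J.convconv, J.cid, eq_comm] at h

theorem ident_comp (x : A) : J.comp J.ident x = x := by
  rw [← J.convconv (J.comp J.ident x), J.convcomp, J.conv_ident, J.cid, J.convconv]

theorem conv_one : J.conv J.one = J.one := by
  refine J.le_antisymm (J.otop _) ?_
  simpa only [J.convconv] using J.conv_le_conv (J.otop (J.conv J.one))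

/-- The Dedekind law. -/
theorem dedekind (x y z : A) :
    J.le (J.meet (J.comp x y) z)
      (J.comp (J.meet (J.comp z (J.conv y)) x) (J.meet y (J.comp (J.conv x) z))) := by
  rw [J.rot]
  exact J.meet_le_left

theorem le_comp_of_one_eq (h : J.one = J.comp x y) (z : A) :
    J.le z (J.comp (J.meet (J.comp z (J.conv y)) x) (J.meet y (J.comp (J.conv x) z))) := by
  have hd := J.dedekind x y z
  rwa [← h, J.mcomm J.one, J.otop] at hd

end JAlgebra

/-- If a, b satisfy (Q), then (a˘·b˘);((a;x;a˘)·(b;b˘));a = x for all x. -/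
theorem U_x0_K {A : Type*} (J : JAlgebra A) (a b : A)
    (ha : J.le (J.comp (J.conv a) a) J.ident)
    (hb : J.le (J.comp (J.conv b) b) J.ident)
    (hQ : J.one = J.comp (J.conv a) b) :
    ∀ x : A,
      J.comp (J.comp (J.meet (J.conv a) (J.conv b))
        (J.meet (J.comp (J.comp a x) (J.conv a)) (J.comp b (J.conv b)))) a = x := by
  intro x
  apply J.le_antisymm
  · have h : J.le _ (J.comp (J.comp (J.conv a) (J.comp (J.comp a x) (J.conv a))) a) :=
      J.comp_le_comp_right (J.comp_le_comp (J.meet_le_left (y := J.conv b))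
        (J.meet_le_left (y := J.comp b (J.conv b)))) a
    refine J.le_trans h ?_
    have h' := J.comp_le_comp (J.comp_le_comp_right ha x) ha
    rw [J.cid, J.ident_comp] at h'
    simpa only [J.cassoc] using h'
  · have hone : J.one = J.comp (J.conv b) a := by
      rw [← J.conv_one, hQ, J.convcomp, J.convconv]
    have hident := J.le_comp_of_one_eq hQ J.ident
    rw [J.ident_comp, J.cid, J.convconv, J.mcomm (J.conv b)] at hident
    have hx := J.le_trans (J.le_comp_of_one_eq hone x)
      (J.comp_le_comp_left J.meet_le_left _)
    have hle := J.comp_le_comp_right hident x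
    rw [J.ident_comp] at hle
    refine J.le_trans hle (J.le_trans (J.comp_le_comp_left hx _) ?_)
    rw [J.cassoc, ← J.cassoc (J.meet (J.conv a) (J.conv b))]
    refine J.comp_le_comp_right (J.comp_le_comp_left (J.le_meet ?_ ?_) _) a
    · rw [← J.cassoc a x]
      exact J.comp_le_comp J.meet_le_right J.meet_le_left
    · exact J.comp_le_comp J.meet_le_left J.meet_le_right
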